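/- Let $\alpha \in (0,1)$, $\theta \in ((1-\alpha)/2 + \epsilon, 1]$ for some $\epsilon>0$ with $\theta + \beta > 1$, and suppose $L \in C^\theta([0,1]; \mathbb{R}^{d\times d})$ pathwise and $Z$ is a bounded adapted $\mathbb{R}^{d\times d\times d}$-valued process with $|Z| \leq K$. Consider the linear hybrid Young–Itô equation $Y^{(\ell)}_t = \int_0^t Y^{(j)}_r\, dL^{(\ell,j)}_r + \int_0^t Z^{(\ell,j,i)}_r Y^{(j)}_r\, dB^{(i)}_r$ with $Y_0 = 0$, where the first integral is a Young integral and the second an Itô integral against a $d$-dimensional Brownian motion $B$. If $Y$ is adapted and almost surely in $C^\beta([0,1];\mathbb{R}^d)$ for some $\beta > 1 - \theta$ with $\beta < 1/2$, then $Y \equiv 0$ almost surely. -/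

import Mathlib

open MeasureTheory ProbabilityTheory Filter ENNReal

structure IsBrownianMotion {Ω : Type} {mΩ : MeasurableSpace Ω} (P : Measure Ω)
    (F : MeasureTheory.Filtration ℝ mΩ) (ι : Type) [Fintype ι]
    (B : ℝ → Ω → (ι → ℝ)) : Prop where
  adapted : ∀ t : ℝ, Measurable[F t] (B t)
  init : ∀ ω, B 0 ω = 0
  contPaths : ∀ᵐ ω ∂P, Continuous fun t => B t ω
  indepPast : ∀ s t : ℝ, 0 ≤ s → s ≤ t →
    ProbabilityTheory.Indep
      (MeasurableSpace.comap (fun ω => B t ω - B s ω) inferInstance) (F s) P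
  incrLaw : ∀ s t : ℝ, 0 ≤ s → s ≤ t →
    Measure.map (fun ω => B t ω - B s ω) P =
      Measure.pi fun _ : ι => ProbabilityTheory.gaussianReal 0 (Real.toNNReal (t - s))

theorem eLpNorm_two_le_ofReal_of_integral_sq_le {Ω : Type*} {mΩ : MeasurableSpace Ω}
    {P : Measure Ω} {f : Ω → ℝ} (hf : MemLp f 2 P) {c : ℝ} (hc : 0 ≤ c)
    (h : ∫ ω, f ω ^ 2 ∂P ≤ c ^ 2) : eLpNorm f 2 P ≤ ENNReal.ofReal c := by
  rw [hf.eLpNorm_eq_integral_rpow_norm two_ne_zero ENNReal.ofNat_ne_top]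
  apply ENNReal.ofReal_le_ofReal
  simp only [ENNReal.toReal_ofNat, Real.rpow_ofNat, Real.norm_eq_abs, sq_abs]
  rw [show (2 : ℝ)⁻¹ = 1 / 2 by norm_num, ← Real.sqrt_eq_rpow]
  exact Real.sqrt_le_iff.2 ⟨hc, h⟩

theorem integral_sq_le_of_eLpNorm_two_le_ofReal {Ω : Type*} {mΩ : MeasurableSpace Ω}
    {P : Measure Ω} {f : Ω → ℝ} (hf : MemLp f 2 P) {c : ℝ} (hc : 0 ≤ c)
    (h : eLpNorm f 2 P ≤ ENNReal.ofReal c) : ∫ ω, f ω ^ 2 ∂P ≤ c ^ 2 := by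
  rw [hf.eLpNorm_eq_integral_rpow_norm two_ne_zero ENNReal.ofNat_ne_top,
    ENNReal.ofReal_le_ofReal_iff hc] at h
  simp only [ENNReal.toReal_ofNat, Real.rpow_ofNat, Real.norm_eq_abs, sq_abs] at h
  rw [show (2 : ℝ)⁻¹ = 1 / 2 by norm_num, ← Real.sqrt_eq_rpow] at h
  exact (Real.sqrt_le_iff.1 h).2

/-- The discrete Itô isometry: predictable bounded integrands against centred square-integrable
increments of common variance `v`, each independent of the past. -/
theorem integral_sq_sum_mul_increment {Ω : Type*} {mΩ : MeasurableSpace Ω} {P : Measure Ω}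
    [IsProbabilityMeasure P] {G : ℕ → MeasurableSpace Ω} (hG : ∀ k, G k ≤ mΩ) (hmono : Monotone G)
    {H D : ℕ → Ω → ℝ} {v : ℝ} (m : ℕ)
    (hH : ∀ k < m, Measurable[G k] (H k)) (hHbd : ∀ k < m, ∃ C, ∀ ω, |H k ω| ≤ C)
    (hD : ∀ k < m, Measurable[G (k + 1)] (D k))
    (hind : ∀ k < m, Indep (MeasurableSpace.comap (D k) inferInstance) (G k) P)
    (hD2 : ∀ k < m, MemLp (D k) 2 P) (hmean : ∀ k < m, ∫ ω, D k ω ∂P = 0)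
    (hvar : ∀ k < m, ∫ ω, D k ω ^ 2 ∂P = v) :
    Measurable[G m] (fun ω => ∑ k ∈ Finset.range m, H k ω * D k ω) ∧
    MemLp (fun ω => ∑ k ∈ Finset.range m, H k ω * D k ω) 2 P ∧
    ∫ ω, (∑ k ∈ Finset.range m, H k ω * D k ω) ^ 2 ∂P =
      v * ∑ k ∈ Finset.range m, ∫ ω, H k ω ^ 2 ∂P := by
  induction m with
  | zero => simp
  | succ m ih =>
    obtain ⟨hSm, hS2, hSI⟩ := ih (fun k hk => hH k (by omega)) (fun k hk => hHbd k (by omega))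
      (fun k hk => hD k (by omega)) (fun k hk => hind k (by omega)) (fun k hk => hD2 k (by omega))
      (fun k hk => hmean k (by omega)) (fun k hk => hvar k (by omega))
    set S : Ω → ℝ := fun ω => ∑ k ∈ Finset.range m, H k ω * D k ω with hS
    have hm : m < m + 1 := Nat.lt_succ_self m
    obtain ⟨C, hC⟩ := hHbd m hm
    have hHm : Measurable (H m) := (hH m hm).mono (hG m) le_rfl
    have hDm : Measurable (D m) := (hD m hm).mono (hG _) le_rfl
    have hHD2 : MemLp (fun ω => H m ω * D m ω) 2 P :=
      (hD2 m hm).of_le_mul (c := C) (hHm.mul hDm).aestronglyMeasurable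
        (ae_of_all _ fun ω => by
          simp only [norm_mul, Real.norm_eq_abs]
          exact mul_le_mul_of_nonneg_right (hC ω) (abs_nonneg _))
    have hSH : Measurable[G m] (fun ω => S ω * H m ω) := hSm.mul (hH m hm)
    have hind1 : IndepFun (fun ω => S ω * H m ω) (D m) P := by
      have := (hind m hm).symm
      exact indep_of_indep_of_le_left this hSH.comap_le
    have hind2 : IndepFun (fun ω => H m ω ^ 2) (fun ω => D m ω ^ 2) P := by
      have h1 : IndepFun (H m) (D m) P :=
        indep_of_indep_of_le_left (hind m hm).symm (hH m hm).comap_le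
      exact h1.comp (φ := fun x => x ^ 2) (ψ := fun x => x ^ 2) (by fun_prop) (by fun_prop)
    have hcross : ∫ ω, (S ω * H m ω) * D m ω ∂P = 0 := by
      rw [hind1.integral_fun_mul_eq_mul_integral (hSH.mono (hG m) le_rfl).aestronglyMeasurable
        hDm.aestronglyMeasurable, hmean m hm, mul_zero]
    have hsq : ∫ ω, (H m ω * D m ω) ^ 2 ∂P = v * ∫ ω, H m ω ^ 2 ∂P := by
      simp_rw [mul_pow]
      rw [hind2.integral_fun_mul_eq_mul_integral (hHm.pow_const 2).aestronglyMeasurable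
        (hDm.pow_const 2).aestronglyMeasurable, hvar m hm, mul_comm]
    have hsum : (fun ω => ∑ k ∈ Finset.range (m + 1), H k ω * D k ω) =
        fun ω => S ω + H m ω * D m ω := by
      funext ω; rw [Finset.sum_range_succ]
    refine ⟨?_, ?_, ?_⟩
    · rw [hsum]
      exact (hSm.mono (hmono (Nat.le_succ m)) le_rfl).add
        (((hH m hm).mono (hmono (Nat.le_succ m)) le_rfl).mul (hD m hm))
    · rw [hsum]; exact hS2.add hHD2
    · simp_rw [Finset.sum_range_succ]
      have hexp : ∀ ω, (S ω + H m ω * D m ω) ^ 2 =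
          S ω ^ 2 + 2 * ((S ω * H m ω) * D m ω) + (H m ω * D m ω) ^ 2 := fun ω => by ring
      have hI1 : Integrable (fun ω => S ω ^ 2) P := hS2.integrable_sq
      have hI3 : Integrable (fun ω => (H m ω * D m ω) ^ 2) P := hHD2.integrable_sq
      have hI2 : Integrable (fun ω => 2 * ((S ω * H m ω) * D m ω)) P := by
        refine Integrable.const_mul ?_ 2
        exact (hS2.integrable_mul hHD2).congr (ae_of_all _ fun ω => by simp [mul_assoc])
      have hI12 : Integrable (fun ω => S ω ^ 2 + 2 * ((S ω * H m ω) * D m ω)) P := hI1.add hI2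
      change ∫ ω, (S ω + H m ω * D m ω) ^ 2 ∂P = _
      simp_rw [hexp]
      rw [integral_add hI12 hI3, integral_add hI1 hI2, integral_const_mul, hcross, hsq,
        hSI]
      ring

theorem IsBrownianMotion.increment_apply {Ω : Type} {mΩ : MeasurableSpace Ω} {P : Measure Ω}
    {F : Filtration ℝ mΩ} {ι : Type} [Fintype ι] {B : ℝ → Ω → (ι → ℝ)}
    (hB : IsBrownianMotion P F ι B) (i : ι) {s t : ℝ} (hs : 0 ≤ s) (hst : s ≤ t) :
    MemLp (fun ω => B t ω i - B s ω i) 2 P ∧ ∫ ω, (B t ω i - B s ω i) ∂P = 0 ∧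
      ∫ ω, (B t ω i - B s ω i) ^ 2 ∂P = t - s := by
  have hBm : ∀ r, Measurable (B r) := fun r => (hB.adapted r).mono (F.le r) le_rfl
  have hvec : Measurable (fun ω => B t ω - B s ω) := (hBm t).sub (hBm s)
  have hm : Measurable (fun ω => B t ω i - B s ω i) := (measurable_pi_apply i).comp hvec
  have hlaw : Measure.map (fun ω => B t ω i - B s ω i) P =
      gaussianReal 0 (Real.toNNReal (t - s)) := by
    have h1 : (fun ω => B t ω i - B s ω i) = (Function.eval i) ∘ fun ω => B t ω - B s ω := rfl
    rw [h1, ← Measure.map_map (measurable_pi_apply i) hvec, hB.incrLaw s t hs hst]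
    exact (measurePreserving_eval (fun _ : ι => gaussianReal 0 (Real.toNNReal (t - s))) i).map_eq
  refine ⟨?_, ?_, ?_⟩
  · have h := memLp_id_gaussianReal' (μ := 0) (v := Real.toNNReal (t - s)) 2 (by simp)
    rw [← hlaw] at h
    exact h.comp_of_map hm.aemeasurable
  · have h := integral_map (μ := P) hm.aemeasurable (f := fun x : ℝ => x)
      measurable_id.aestronglyMeasurable
    rw [← h, hlaw, integral_id_gaussianReal]
  · have h := integral_map (μ := P) hm.aemeasurable (f := fun x : ℝ => x ^ 2)
      (measurable_id.pow_const 2).aestronglyMeasurable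
    have hv := variance_fun_id_gaussianReal (μ := 0) (v := Real.toNNReal (t - s))
    rw [variance_eq_integral (by fun_prop), integral_id_gaussianReal] at hv
    rw [← h, hlaw]
    simpa [Real.coe_toNNReal _ (sub_nonneg.2 hst)] using hv

/-- The dyadic point `k / 2 ^ n`. -/
noncomputable def dyadic (n k : ℕ) : ℝ := k / 2 ^ n

theorem dyadic_nonneg (n k : ℕ) : 0 ≤ dyadic n k := by unfold dyadic; positivity

theorem dyadic_mono (n : ℕ) {k l : ℕ} (h : k ≤ l) : dyadic n k ≤ dyadic n l := by
  unfold dyadic; gcongr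

theorem dyadic_le_one {n k : ℕ} (h : k ≤ 2 ^ n) : dyadic n k ≤ 1 := by
  unfold dyadic
  rw [div_le_one (by positivity)]
  exact_mod_cast h

theorem dyadic_mem_Icc {n k : ℕ} (h : k ≤ 2 ^ n) : dyadic n k ∈ Set.Icc (0 : ℝ) 1 :=
  ⟨dyadic_nonneg n k, dyadic_le_one h⟩

theorem dyadic_add_mul_pow (n k p : ℕ) : dyadic (n + p) (k * 2 ^ p) = dyadic n k := by
  unfold dyadic; push_cast; rw [pow_add]; field_simp

theorem dyadic_succ_two_mul (n k : ℕ) : dyadic (n + 1) (2 * k) = dyadic n k := by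
  rw [mul_comm, ← dyadic_add_mul_pow n k 1, pow_one]

theorem dyadic_zero_right (n : ℕ) : dyadic n 0 = 0 := by simp [dyadic]

theorem dyadic_succ_sub (n k : ℕ) : dyadic n (k + 1) - dyadic n k = (1 / 2) ^ n := by
  unfold dyadic; push_cast; rw [one_div, inv_pow]; field_simp; ring

theorem dyadic_succ_sub_rpow (n k : ℕ) (γ : ℝ) :
    (dyadic n (k + 1) - dyadic n k) ^ γ = ((1 / 2 : ℝ) ^ γ) ^ n := by
  rw [dyadic_succ_sub, ← Real.rpow_natCast, ← Real.rpow_natCast, ← Real.rpow_mul (by norm_num),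
    ← Real.rpow_mul (by norm_num), mul_comm]

/-- The action of a matrix of Young increments on a vector. -/
def youngTerm {d : ℕ} (y : Fin d → ℝ) (M : Fin d → Fin d → ℝ) : Fin d → ℝ :=
  fun l => ∑ j, y j * M l j

/-- The action of the diffusion coefficient on a vector and a Brownian increment. -/
def itoTerm {d : ℕ} (z : Fin d → Fin d → Fin d → ℝ) (y b : Fin d → ℝ) : Fin d → ℝ :=
  fun l => ∑ j, ∑ i, z l j i * y j * b i

theorem youngTerm_refine {d : ℕ} (a b : Fin d → ℝ) (u v w : Fin d → Fin d → ℝ) :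
    youngTerm a (v - u) + youngTerm b (w - v) =
      youngTerm a (w - u) + youngTerm (b - a) (w - v) := by
  funext l
  simp only [youngTerm, Pi.add_apply, Pi.sub_apply, ← Finset.sum_add_distrib]
  exact Finset.sum_congr rfl fun j _ => by ring

theorem norm_youngTerm_le {d : ℕ} (y : Fin d → ℝ) (M : Fin d → Fin d → ℝ) :
    ‖youngTerm y M‖ ≤ d * ‖M‖ * ‖y‖ := by
  refine (pi_norm_le_iff_of_nonneg (by positivity)).2 fun l => ?_
  calc ‖∑ j, y j * M l j‖ ≤ ∑ j : Fin d, ‖M‖ * ‖y‖ := by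
        refine norm_sum_le_of_le _ fun j _ => ?_
        rw [norm_mul, mul_comm]
        gcongr
        · exact (norm_le_pi_norm (M l) j).trans (norm_le_pi_norm M l)
        · exact norm_le_pi_norm y j
    _ = d * ‖M‖ * ‖y‖ := by simp [mul_assoc]

theorem measurable_youngTerm {d : ℕ} {Ω : Type*} [MeasurableSpace Ω] {y : Ω → Fin d → ℝ}
    {M : Ω → Fin d → Fin d → ℝ} (hy : Measurable y) (hM : Measurable M) :
    Measurable fun ω => youngTerm (y ω) (M ω) := by
  unfold youngTerm; fun_prop

theorem measurable_itoTerm {d : ℕ} {Ω : Type*} [MeasurableSpace Ω]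
    {z : Ω → Fin d → Fin d → Fin d → ℝ} {y b : Ω → Fin d → ℝ} (hz : Measurable z)
    (hy : Measurable y) (hb : Measurable b) : Measurable fun ω => itoTerm (z ω) (y ω) (b ω) := by
  unfold itoTerm; fun_prop

theorem sum_range_two_mul {M : Type*} [AddCommMonoid M] (f : ℕ → M) (m : ℕ) :
    ∑ l ∈ Finset.range (2 * m), f l = ∑ l ∈ Finset.range m, (f (2 * l) + f (2 * l + 1)) := by
  induction m with
  | zero => simp
  | succ m ih =>
    rw [show 2 * (m + 1) = 2 * m + 1 + 1 by ring, Finset.sum_range_succ, Finset.sum_range_succ,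
      Finset.sum_range_succ, ih, add_assoc]

theorem sum_range_pow_le {r : ℝ} (h0 : 0 ≤ r) (h1 : r < 1) (p : ℕ) :
    ∑ q ∈ Finset.range p, r ^ q ≤ 1 / (1 - r) := by
  rw [one_div, ← tsum_geometric_of_lt_one h0 h1]
  exact (summable_geometric_of_lt_one h0 h1).sum_le_tsum _ fun i _ => by positivity

/-- The left-point Young sum over the dyadic interval `[k / 2 ^ n, (k + 1) / 2 ^ n]` with mesh
`2 ^ (-(n + p))`. -/
noncomputable def youngSum {d : ℕ} {Ω : Type} (Y : ℝ → Ω → Fin d → ℝ)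
    (L : ℝ → Ω → Fin d → Fin d → ℝ) (n k p : ℕ) (ω : Ω) : Fin d → ℝ :=
  ∑ l ∈ Finset.range (2 ^ p), youngTerm (Y (dyadic (n + p) (k * 2 ^ p + l)) ω)
    (L (dyadic (n + p) (k * 2 ^ p + l + 1)) ω - L (dyadic (n + p) (k * 2 ^ p + l)) ω)

/-- The left-point Itô sum over the dyadic interval `[k / 2 ^ n, (k + 1) / 2 ^ n]` with mesh
`2 ^ (-(n + p))`. -/
noncomputable def itoSum {d : ℕ} {Ω : Type} (Z : ℝ → Ω → Fin d → Fin d → Fin d → ℝ)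
    (Y B : ℝ → Ω → Fin d → ℝ) (n k p : ℕ) (ω : Ω) : Fin d → ℝ :=
  ∑ l ∈ Finset.range (2 ^ p), itoTerm (Z (dyadic (n + p) (k * 2 ^ p + l)) ω)
    (Y (dyadic (n + p) (k * 2 ^ p + l)) ω)
    (B (dyadic (n + p) (k * 2 ^ p + l + 1)) ω - B (dyadic (n + p) (k * 2 ^ p + l)) ω)

theorem youngSum_succ {d : ℕ} {Ω : Type} (Y : ℝ → Ω → Fin d → ℝ)
    (L : ℝ → Ω → Fin d → Fin d → ℝ) (n k p : ℕ) (ω : Ω) :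
    youngSum Y L n k (p + 1) ω = youngSum Y L n k p ω + ∑ l ∈ Finset.range (2 ^ p),
      youngTerm (Y (dyadic (n + (p + 1)) (2 * (k * 2 ^ p + l) + 1)) ω -
          Y (dyadic (n + p) (k * 2 ^ p + l)) ω)
        (L (dyadic (n + p) (k * 2 ^ p + l + 1)) ω -
          L (dyadic (n + (p + 1)) (2 * (k * 2 ^ p + l) + 1)) ω) := by
  unfold youngSum
  rw [pow_succ', sum_range_two_mul, ← Finset.sum_add_distrib]
  refine Finset.sum_congr rfl fun l _ => ?_
  have h0 : k * (2 * 2 ^ p) + 2 * l = 2 * (k * 2 ^ p + l) := by ring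
  have h2 : 2 * (k * 2 ^ p + l) + 1 + 1 = 2 * (k * 2 ^ p + l + 1) := by ring
  rw [← add_assoc (k * (2 * 2 ^ p)), h0, h2, ← add_assoc n p 1, dyadic_succ_two_mul,
    dyadic_succ_two_mul, youngTerm_refine]

/-- A solution of the hybrid Young–Itô equation, seen along dyadic times, together with a
decreasing adapted family of events on which `Y` and `L` have geometrically bounded dyadic
increments. -/
structure LocalizedSolution {d : ℕ} {Ω : Type} {mΩ : MeasurableSpace Ω} (P : Measure Ω)
    (F : Filtration ℝ mΩ) (B Y : ℝ → Ω → Fin d → ℝ) (L : ℝ → Ω → Fin d → Fin d → ℝ)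
    (Z : ℝ → Ω → Fin d → Fin d → Fin d → ℝ) (A : ℝ → Set Ω) (N K ρ σ : ℝ) : Prop where
  brownian : IsBrownianMotion P F (Fin d) B
  adapted_Y : ∀ t, Measurable[F t] (Y t)
  adapted_L : ∀ t, Measurable[F t] (L t)
  adapted_Z : ∀ t, Measurable[F t] (Z t)
  measurableSet_A : ∀ t, MeasurableSet[F t] (A t)
  antitone_A : Antitone A
  N_nonneg : 0 ≤ N
  K_nonneg : 0 ≤ K
  ρ_pos : 0 < ρ
  σ_pos : 0 < σ
  norm_Z_le : ∀ t ∈ Set.Icc (0 : ℝ) 1, ∀ ω, ‖Z t ω‖ ≤ K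
  initial : ∀ ω, Y 0 ω = 0
  norm_Y_le : ∀ n k, k ≤ 2 ^ n → ∀ ω ∈ A (dyadic n k), ‖Y (dyadic n k) ω‖ ≤ N
  norm_Y_sub_le : ∀ n k, k < 2 ^ n → ∀ ω ∈ A (dyadic n (k + 1)),
    ‖Y (dyadic n (k + 1)) ω - Y (dyadic n k) ω‖ ≤ N * ρ ^ n
  norm_L_sub_le : ∀ n k, k < 2 ^ n → ∀ ω ∈ A (dyadic n (k + 1)),
    ‖L (dyadic n (k + 1)) ω - L (dyadic n k) ω‖ ≤ N * σ ^ n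
  tendsto_increment : ∀ n k, k < 2 ^ n → ∃ ns : ℕ → ℕ, ∀ᵐ ω ∂P,
    Tendsto (fun q => youngSum Y L n k (ns q) ω + itoSum Z Y B n k (ns q) ω) atTop
      (nhds (Y (dyadic n (k + 1)) ω - Y (dyadic n k) ω))

/-- The localized size of `Y` at a dyadic time. -/
noncomputable def localSize {d : ℕ} {Ω : Type} {mΩ : MeasurableSpace Ω} (P : Measure Ω)
    (Y : ℝ → Ω → Fin d → ℝ) (A : ℝ → Set Ω) (n k : ℕ) : ℝ≥0∞ :=
  eLpNorm ((A (dyadic n k)).indicator (Y (dyadic n k))) 2 P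

/-- The localized size of a dyadic increment of `Y`. -/
noncomputable def localIncr {d : ℕ} {Ω : Type} {mΩ : MeasurableSpace Ω} (P : Measure Ω)
    (Y : ℝ → Ω → Fin d → ℝ) (A : ℝ → Set Ω) (n k : ℕ) : ℝ≥0∞ :=
  eLpNorm ((A (dyadic n (k + 1))).indicator (Y (dyadic n (k + 1)) - Y (dyadic n k))) 2 P

theorem eLpNorm_indicator_youngTerm_le {d : ℕ} {Ω : Type} {mΩ : MeasurableSpace Ω}
    {P : Measure Ω} {S T : Set Ω} (hTS : T ⊆ S) (X : Ω → Fin d → ℝ)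
    (M : Ω → Fin d → Fin d → ℝ) {a c : ℝ} (ha : 0 ≤ a) (hM : ∀ ω ∈ T, ‖M ω‖ ≤ a)
    (hX : eLpNorm (S.indicator X) 2 P ≤ ENNReal.ofReal c) :
    eLpNorm (T.indicator fun ω => youngTerm (X ω) (M ω)) 2 P ≤ ENNReal.ofReal (d * a * c) := by
  have hda : 0 ≤ d * a := by positivity
  rw [ENNReal.ofReal_mul hda]
  refine (eLpNorm_le_mul_eLpNorm_of_ae_le_mul (c := d * a) (g := S.indicator X)
    (ae_of_all _ fun ω => ?_) 2).trans (mul_le_mul_right hX _)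
  by_cases hω : ω ∈ T
  · rw [Set.indicator_of_mem hω, Set.indicator_of_mem (hTS hω)]
    refine (norm_youngTerm_le _ _).trans ?_
    gcongr
    exact hM ω hω
  · rw [Set.indicator_of_notMem hω, norm_zero]; positivity

theorem eLpNorm_finset_sum_le_ofReal {ι Ω E : Type*} [NormedAddCommGroup E]
    {mΩ : MeasurableSpace Ω} {P : Measure Ω} (s : Finset ι) {f : ι → Ω → E} {c : ℝ}
    (hf : ∀ i ∈ s, AEStronglyMeasurable (f i) P)
    (h : ∀ i ∈ s, eLpNorm (f i) 2 P ≤ ENNReal.ofReal c) :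
    eLpNorm (∑ i ∈ s, f i) 2 P ≤ ENNReal.ofReal (s.card * c) := by
  refine (eLpNorm_sum_le hf one_le_two).trans ((Finset.sum_le_sum h).trans ?_)
  rw [Finset.sum_const, nsmul_eq_mul, ENNReal.ofReal_mul (by positivity), ENNReal.ofReal_natCast]

theorem subinterval_lt {n k p l : ℕ} (hk : k < 2 ^ n) (hl : l < 2 ^ p) :
    k * 2 ^ p + l < 2 ^ (n + p) := by
  rw [pow_add]; nlinarith [Nat.mul_le_mul_right (2 ^ p) (Nat.succ_le_of_lt hk)]

theorem dyadic_subinterval_le {n k p l : ℕ} (hl : l < 2 ^ p) :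
    dyadic (n + p) (k * 2 ^ p + l + 1) ≤ dyadic n (k + 1) := by
  rw [← dyadic_add_mul_pow n (k + 1) p]
  exact dyadic_mono _ (by rw [add_mul, one_mul]; omega)

namespace LocalizedSolution

variable {d : ℕ} {Ω : Type} {mΩ : MeasurableSpace Ω} {P : Measure Ω}
  {F : Filtration ℝ mΩ} {B Y : ℝ → Ω → Fin d → ℝ} {L : ℝ → Ω → Fin d → Fin d → ℝ}
  {Z : ℝ → Ω → Fin d → Fin d → Fin d → ℝ} {A : ℝ → Set Ω} {N K ρ σ : ℝ}

theorem measurable_Y (h : LocalizedSolution P F B Y L Z A N K ρ σ) (t : ℝ) : Measurable (Y t) :=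
  (h.adapted_Y t).mono (F.le t) le_rfl

theorem measurable_L (h : LocalizedSolution P F B Y L Z A N K ρ σ) (t : ℝ) : Measurable (L t) :=
  (h.adapted_L t).mono (F.le t) le_rfl

theorem measurable_Z (h : LocalizedSolution P F B Y L Z A N K ρ σ) (t : ℝ) : Measurable (Z t) :=
  (h.adapted_Z t).mono (F.le t) le_rfl

theorem measurable_B (h : LocalizedSolution P F B Y L Z A N K ρ σ) (t : ℝ) : Measurable (B t) :=
  (h.brownian.adapted t).mono (F.le t) le_rfl

theorem measurableSet (h : LocalizedSolution P F B Y L Z A N K ρ σ) (t : ℝ) :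
    MeasurableSet (A t) := F.le t _ (h.measurableSet_A t)

theorem measurable_youngSum (h : LocalizedSolution P F B Y L Z A N K ρ σ) (n k p : ℕ) :
    Measurable (youngSum Y L n k p) :=
  Finset.measurable_fun_sum _ fun _ _ =>
    measurable_youngTerm (h.measurable_Y _) ((h.measurable_L _).sub (h.measurable_L _))

theorem measurable_itoSum (h : LocalizedSolution P F B Y L Z A N K ρ σ) (n k p : ℕ) :
    Measurable (itoSum Z Y B n k p) :=
  Finset.measurable_fun_sum _ fun _ _ =>
    measurable_itoTerm (h.measurable_Z _) (h.measurable_Y _)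
      ((h.measurable_B _).sub (h.measurable_B _))

/-- The sewing estimate in `L²` for the Young sums. -/
theorem eLpNorm_youngSum_le (h : LocalizedSolution P F B Y L Z A N K ρ σ) {n k : ℕ}
    (hk : k < 2 ^ n) {G S : ℝ} (hG : 0 ≤ G) (hS : 0 ≤ S)
    (hD : ∀ p, ∀ l < 2 ^ p,
      localIncr P Y A (n + p) (k * 2 ^ p + l) ≤ ENNReal.ofReal (G * ρ ^ (n + p)))
    (hV : ∀ p, ∀ l < 2 ^ p, localSize P Y A (n + p) (k * 2 ^ p + l) ≤ ENNReal.ofReal S) (p : ℕ) :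
    eLpNorm ((A (dyadic n (k + 1))).indicator (youngSum Y L n k p)) 2 P ≤
      ENNReal.ofReal (d * (N * σ ^ n) * S + ∑ q ∈ Finset.range p,
        2 ^ q * (d * (N * σ ^ (n + (q + 1))) * (G * ρ ^ (n + (q + 1))))) := by
  have hN := h.N_nonneg
  have hσ := h.σ_pos
  have hρ := h.ρ_pos
  induction p with
  | zero =>
    have h0 := hV 0 0 (by simp)
    simp only [pow_zero, mul_one, add_zero] at h0
    have := eLpNorm_indicator_youngTerm_le (P := P)
      (h.antitone_A (dyadic_mono n (Nat.le_succ k))) (Y (dyadic n k))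
      (fun ω => L (dyadic n (k + 1)) ω - L (dyadic n k) ω) (a := N * σ ^ n) (by positivity)
      (h.norm_L_sub_le n k hk) h0
    have hzero : youngSum Y L n k 0 = fun ω =>
        youngTerm (Y (dyadic n k) ω) (L (dyadic n (k + 1)) ω - L (dyadic n k) ω) := by
      funext ω; simp [youngSum]
    rw [hzero]
    simpa using this
  | succ p ih =>
    rw [Finset.sum_range_succ, ← add_assoc, ENNReal.ofReal_add (by positivity) (by positivity)]
    set T := A (dyadic n (k + 1)) with hT
    have hTm : MeasurableSet T := h.measurableSet _
    let R : ℕ → Ω → Fin d → ℝ := fun l ω =>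
      youngTerm (Y (dyadic (n + (p + 1)) (2 * (k * 2 ^ p + l) + 1)) ω -
          Y (dyadic (n + p) (k * 2 ^ p + l)) ω)
        (L (dyadic (n + p) (k * 2 ^ p + l + 1)) ω -
          L (dyadic (n + (p + 1)) (2 * (k * 2 ^ p + l) + 1)) ω)
    have hRm : ∀ l, Measurable (R l) := fun l =>
      measurable_youngTerm ((h.measurable_Y _).sub (h.measurable_Y _))
        ((h.measurable_L _).sub (h.measurable_L _))
    have hsplit : T.indicator (youngSum Y L n k (p + 1)) =
        T.indicator (youngSum Y L n k p) + ∑ l ∈ Finset.range (2 ^ p), T.indicator (R l) := by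
      funext ω
      by_cases hω : ω ∈ T
      · simp only [Pi.add_apply, Finset.sum_apply, Set.indicator_of_mem hω]
        exact youngSum_succ Y L n k p ω
      · simp [hω]
    rw [hsplit]
    refine (eLpNorm_add_le ((h.measurable_youngSum n k p).indicator hTm).aestronglyMeasurable
      (Finset.aestronglyMeasurable_sum _ fun l _ => ((hRm l).indicator hTm).aestronglyMeasurable)
      one_le_two).trans (add_le_add ih ?_)
    refine (eLpNorm_finset_sum_le_ofReal (c := d * (N * σ ^ (n + (p + 1))) *
      (G * ρ ^ (n + (p + 1)))) _
      (fun l _ => ((hRm l).indicator hTm).aestronglyMeasurable) fun l hl => ?_).trans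
      (by simp)
    rw [Finset.mem_range] at hl
    have hidx : 2 * (k * 2 ^ p + l) = k * 2 ^ (p + 1) + 2 * l := by ring
    have hle : 2 * l + 1 < 2 ^ (p + 1) := by rw [pow_succ]; omega
    have hincr := hD (p + 1) (2 * l) (by omega)
    have hleft : dyadic (n + p) (k * 2 ^ p + l) =
        dyadic (n + (p + 1)) (k * 2 ^ (p + 1) + 2 * l) := by
      rw [← hidx, ← add_assoc, dyadic_succ_two_mul]
    have hright : dyadic (n + p) (k * 2 ^ p + l + 1) =
        dyadic (n + (p + 1)) (k * 2 ^ (p + 1) + (2 * l + 1) + 1) := by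
      rw [show k * 2 ^ (p + 1) + (2 * l + 1) + 1 = 2 * (k * 2 ^ p + l + 1) by ring, ← add_assoc n,
        dyadic_succ_two_mul]
    have hT1 : T ⊆ A (dyadic (n + (p + 1)) (k * 2 ^ (p + 1) + (2 * l + 1) + 1)) :=
      h.antitone_A (dyadic_subinterval_le hle)
    have hT2 : T ⊆ A (dyadic (n + (p + 1)) (k * 2 ^ (p + 1) + 2 * l + 1)) :=
      hT1.trans (h.antitone_A (dyadic_mono _ (by omega)))
    have hb := eLpNorm_indicator_youngTerm_le hT2 _
      (fun ω => L (dyadic (n + (p + 1)) (k * 2 ^ (p + 1) + (2 * l + 1) + 1)) ω -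
          L (dyadic (n + (p + 1)) (k * 2 ^ (p + 1) + (2 * l + 1))) ω) (by positivity)
      (fun ω hω => h.norm_L_sub_le _ _ (subinterval_lt hk hle) ω (hT1 hω)) hincr
    simp only [R, hidx, hleft, hright]
    exact hb

/-- The Itô isometry estimate for the Itô sums. -/
theorem eLpNorm_itoSum_le [IsProbabilityMeasure P]
    (h : LocalizedSolution P F B Y L Z A N K ρ σ) {n k : ℕ}
    (hk : k < 2 ^ n) {S : ℝ} (hS : 0 ≤ S)
    (hV : ∀ p, ∀ l < 2 ^ p, localSize P Y A (n + p) (k * 2 ^ p + l) ≤ ENNReal.ofReal S) (p : ℕ) :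
    eLpNorm ((A (dyadic n (k + 1))).indicator (itoSum Z Y B n k p)) 2 P ≤
      ENNReal.ofReal (d ^ 3 * (K * S * √(1 / 2) ^ n)) := by
  have hN := h.N_nonneg
  have hK := h.K_nonneg
  set T := A (dyadic n (k + 1)) with hT
  let t : ℕ → ℝ := fun l => dyadic (n + p) (k * 2 ^ p + l)
  have ht_mono : Monotone t := fun a b hab => dyadic_mono _ (by omega)
  have ht0 : ∀ l, 0 ≤ t l := fun l => dyadic_nonneg _ _
  have hlt : ∀ l < 2 ^ p, k * 2 ^ p + l < 2 ^ (n + p) := fun l hl => subinterval_lt hk hl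
  have ht1 : ∀ l < 2 ^ p, t l ∈ Set.Icc (0 : ℝ) 1 := fun l hl => dyadic_mem_Icc (hlt l hl).le
  have hTt : ∀ l < 2 ^ p, T ⊆ A (t l) := fun l hl =>
    (h.antitone_A (dyadic_subinterval_le hl)).trans (h.antitone_A (dyadic_mono _ (by omega)))
  let H : Fin d × Fin d × Fin d → ℕ → Ω → ℝ := fun x l =>
    (A (t l)).indicator fun ω => Z (t l) ω x.1 x.2.1 x.2.2 * Y (t l) ω x.2.1
  let D : Fin d × Fin d × Fin d → ℕ → Ω → ℝ := fun x l ω =>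
    B (t (l + 1)) ω x.2.2 - B (t l) ω x.2.2
  let M : Fin d × Fin d × Fin d → Ω → ℝ := fun x ω => ∑ l ∈ Finset.range (2 ^ p), H x l ω * D x l ω
  have hYS : ∀ l < 2 ^ p, eLpNorm ((A (t l)).indicator (Y (t l))) 2 P ≤ ENNReal.ofReal S :=
    fun l hl => hV p l hl
  have hHm : ∀ x l, Measurable[F (t l)] (H x l) := fun x l => by
    have hz : Measurable[F (t l)] fun ω => Z (t l) ω x.1 x.2.1 x.2.2 :=
      (measurable_pi_apply x.2.2).comp ((measurable_pi_apply x.2.1).comp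
        ((measurable_pi_apply x.1).comp (h.adapted_Z (t l))))
    have hy : Measurable[F (t l)] fun ω => Y (t l) ω x.2.1 :=
      (measurable_pi_apply x.2.1).comp (h.adapted_Y (t l))
    exact (hz.mul hy).indicator (h.measurableSet_A _)
  have hHK : ∀ x, ∀ l < 2 ^ p, ∀ ω, ‖H x l ω‖ ≤ K * ‖(A (t l)).indicator (Y (t l)) ω‖ := by
    intro x l hl ω
    by_cases hω : ω ∈ A (t l)
    · simp only [H, Set.indicator_of_mem hω, norm_mul]
      have hz := h.norm_Z_le (t l) (ht1 l hl) ω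
      gcongr
      · exact (norm_le_pi_norm _ _).trans ((norm_le_pi_norm _ _).trans
          ((norm_le_pi_norm (Z (t l) ω) x.1).trans hz))
      · exact norm_le_pi_norm _ _
    · simp [H, hω]
  have hHbd : ∀ x, ∀ l < 2 ^ p, ∀ ω, |H x l ω| ≤ K * N := by
    intro x l hl ω
    refine (hHK x l hl ω).trans (mul_le_mul_of_nonneg_left ?_ hK)
    by_cases hω : ω ∈ A (t l)
    · rw [Set.indicator_of_mem hω]; exact h.norm_Y_le _ _ (hlt l hl).le ω hω
    · rw [Set.indicator_of_notMem hω, norm_zero]; exact hN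
  have hH2 : ∀ x, ∀ l < 2 ^ p, ∫ ω, H x l ω ^ 2 ∂P ≤ (K * S) ^ 2 := by
    intro x l hl
    refine integral_sq_le_of_eLpNorm_two_le_ofReal
      (MemLp.of_bound ((hHm x l).mono (F.le _) le_rfl).aestronglyMeasurable (K * N)
        (ae_of_all _ (hHbd x l hl))) (by positivity) ?_
    rw [ENNReal.ofReal_mul hK]
    exact (eLpNorm_le_mul_eLpNorm_of_ae_le_mul (ae_of_all _ (hHK x l hl)) 2).trans
      (mul_le_mul_right (hYS l hl) _)
  have hB := h.brownian
  have hM : ∀ x, Measurable (M x) ∧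
      eLpNorm (M x) 2 P ≤ ENNReal.ofReal (K * S * √(1 / 2) ^ n) := by
    intro x
    have hincr := fun l => hB.increment_apply x.2.2 (ht0 l) (ht_mono (Nat.le_succ l))
    obtain ⟨hm, h2, hI⟩ := integral_sq_sum_mul_increment (P := P) (G := fun l => F (t l))
      (fun l => F.le _) (fun a b hab => F.mono (ht_mono hab)) (H := H x) (D := D x)
      (v := (1 / 2) ^ (n + p)) (2 ^ p) (fun l _ => hHm x l)
      (fun l hl => ⟨K * N, hHbd x l hl⟩)
      (fun l _ => ((measurable_pi_apply x.2.2).comp (hB.adapted _)).sub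
        ((measurable_pi_apply x.2.2).comp
          ((hB.adapted _).mono (F.mono (ht_mono (Nat.le_succ l))) le_rfl)))
      (fun l _ => indep_of_indep_of_le_left
        (hB.indepPast (t l) (t (l + 1)) (ht0 l) (ht_mono (Nat.le_succ l))) (by
          have : D x l = (fun v : Fin d → ℝ => v x.2.2) ∘ fun ω => B (t (l + 1)) ω - B (t l) ω :=
            rfl
          rw [this, ← MeasurableSpace.comap_comp]
          exact MeasurableSpace.comap_mono (measurable_pi_apply x.2.2).comap_le))
      (fun l _ => (hincr l).1) (fun l _ => (hincr l).2.1)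
      (fun l _ => (hincr l).2.2.trans (dyadic_succ_sub _ _))
    refine ⟨hm.mono (F.le _) le_rfl, eLpNorm_two_le_ofReal_of_integral_sq_le h2 (by positivity) ?_⟩
    rw [hI]
    calc (1 / 2 : ℝ) ^ (n + p) * ∑ l ∈ Finset.range (2 ^ p), ∫ ω, H x l ω ^ 2 ∂P
        ≤ (1 / 2 : ℝ) ^ (n + p) * ∑ l ∈ Finset.range (2 ^ p), (K * S) ^ 2 := by
          gcongr with l hl
          exact hH2 x l (Finset.mem_range.1 hl)
      _ = (K * S * √(1 / 2) ^ n) ^ 2 := by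
          rw [mul_pow _ (√(1 / 2) ^ n), ← pow_mul, mul_comm n 2, pow_mul,
            Real.sq_sqrt (by norm_num), pow_add]
          simp only [Finset.sum_const, Finset.card_range, nsmul_eq_mul, one_div, inv_pow,
            Nat.cast_pow, Nat.cast_ofNat]
          field_simp
  have hdom : ∀ ω, ‖T.indicator (itoSum Z Y B n k p) ω‖ ≤ ‖(∑ x, fun ω => ‖M x ω‖) ω‖ := by
    intro ω
    have hnn : 0 ≤ (∑ x, fun ω => ‖M x ω‖) ω := by
      rw [Finset.sum_apply]; positivity
    rw [Real.norm_of_nonneg hnn, Finset.sum_apply]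
    by_cases hω : ω ∈ T
    · rw [Set.indicator_of_mem hω]
      refine (pi_norm_le_iff_of_nonneg (by positivity)).2 fun a => ?_
      have hEq : itoSum Z Y B n k p ω a = ∑ y : Fin d × Fin d, M (a, y) ω := by
        simp only [itoSum, itoTerm, Finset.sum_apply, M]
        rw [Finset.sum_comm (s := Finset.univ)]
        refine Finset.sum_congr rfl fun l hl => ?_
        rw [Fintype.sum_prod_type]
        refine Finset.sum_congr rfl fun j _ => Finset.sum_congr rfl fun i _ => ?_
        simp only [H, D, Set.indicator_of_mem (hTt l (Finset.mem_range.1 hl) hω)]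
        rfl
      rw [hEq, Fintype.sum_prod_type (f := fun x => ‖M x ω‖)]
      exact (norm_sum_le _ _).trans (Finset.single_le_sum
        (f := fun a => ∑ y : Fin d × Fin d, ‖M (a, y) ω‖)
        (fun _ _ => by positivity) (Finset.mem_univ a))
    · rw [Set.indicator_of_notMem hω, norm_zero]; positivity
  refine (eLpNorm_mono hdom).trans ((eLpNorm_finset_sum_le_ofReal (c := K * S * √(1 / 2) ^ n)
    _ (fun x _ => (hM x).1.norm.aestronglyMeasurable)
    fun x _ => (eLpNorm_norm (M x)).trans_le (hM x).2).trans (le_of_eq ?_))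
  congr 1
  simp [pow_succ, mul_assoc]

/-- The a priori estimate for the increment over a dyadic interval. -/
theorem localIncr_le [IsProbabilityMeasure P]
    (h : LocalizedSolution P F B Y L Z A N K ρ σ) {n k : ℕ}
    (hk : k < 2 ^ n) {G S : ℝ} (hG : 0 ≤ G) (hS : 0 ≤ S)
    (hστ : σ ≤ √(1 / 2)) (hρ1 : ρ < 1) (hρσ : 2 * (ρ * σ) < 1)
    (hD : ∀ p, ∀ l < 2 ^ p,
      localIncr P Y A (n + p) (k * 2 ^ p + l) ≤ ENNReal.ofReal (G * ρ ^ (n + p)))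
    (hV : ∀ p, ∀ l < 2 ^ p, localSize P Y A (n + p) (k * 2 ^ p + l) ≤ ENNReal.ofReal S) :
    localIncr P Y A n k ≤ ENNReal.ofReal
      ((d * N * S + d * N * G * (1 / (1 - 2 * (ρ * σ))) + d ^ 3 * K * S) * √(1 / 2) ^ n) := by
  have hN := h.N_nonneg
  have hK := h.K_nonneg
  have hσ := h.σ_pos
  have hρ := h.ρ_pos
  set T := A (dyadic n (k + 1)) with hT
  have hTm : MeasurableSet T := h.measurableSet _
  obtain ⟨ns, hns⟩ := h.tendsto_increment n k hk
  have hYm := fun q => ((h.measurable_youngSum n k (ns q)).indicator hTm).aestronglyMeasurable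
    (μ := P)
  have hIm := fun q => ((h.measurable_itoSum n k (ns q)).indicator hTm).aestronglyMeasurable
    (μ := P)
  refine (Lp.eLpNorm_lim_le_liminf_eLpNorm (p := 2)
    (f := fun q => T.indicator (youngSum Y L n k (ns q)) +
      T.indicator (itoSum Z Y B n k (ns q)))
    (fun q => (hYm q).add (hIm q)) _ ?_).trans ?_
  · filter_upwards [hns] with ω hω
    by_cases hωT : ω ∈ A (dyadic n (k + 1))
    · simpa [hT, Set.indicator_of_mem hωT] using hω
    · simp [hT, hωT]
  · refine liminf_le_of_le (by isBoundedDefault) fun b hb => ?_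
    obtain ⟨q, hq⟩ := hb.exists
    refine hq.trans ((eLpNorm_add_le (hYm q) (hIm q) one_le_two).trans
      ((add_le_add (h.eLpNorm_youngSum_le hk hG hS hD hV (ns q))
        (h.eLpNorm_itoSum_le hk hS hV (ns q))).trans ?_))
    rw [← ENNReal.ofReal_add (by positivity) (by positivity)]
    apply ENNReal.ofReal_le_ofReal
    have hρσn : (ρ * σ) ^ n ≤ √(1 / 2) ^ n := by
      gcongr
      nlinarith
    have hsum : ∑ q ∈ Finset.range (ns q),
        2 ^ q * (d * (N * σ ^ (n + (q + 1))) * (G * ρ ^ (n + (q + 1)))) ≤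
          d * N * G * (1 / (1 - 2 * (ρ * σ))) * √(1 / 2) ^ n := by
      calc _ = d * N * G * (ρ * σ) ^ n * (ρ * σ) *
            ∑ q ∈ Finset.range (ns q), (2 * (ρ * σ)) ^ q := by
            rw [Finset.mul_sum]
            refine Finset.sum_congr rfl fun q _ => ?_
            ring
        _ ≤ d * N * G * √(1 / 2) ^ n * 1 * (1 / (1 - 2 * (ρ * σ))) := by
            gcongr
            · nlinarith
            · exact sum_range_pow_le (by positivity) hρσ _
        _ = _ := by ring
    have hσn : d * (N * σ ^ n) * S ≤ d * N * S * √(1 / 2) ^ n := by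
      calc _ = d * N * S * σ ^ n := by ring
        _ ≤ _ := by gcongr
    linarith

end LocalizedSolution

theorem localSize_add_mul_pow {d : ℕ} {Ω : Type} {mΩ : MeasurableSpace Ω} (P : Measure Ω)
    (Y : ℝ → Ω → Fin d → ℝ) (A : ℝ → Set Ω) (n k p : ℕ) :
    localSize P Y A (n + p) (k * 2 ^ p) = localSize P Y A n k := by
  simp only [localSize, dyadic_add_mul_pow]

namespace LocalizedSolution

variable {d : ℕ} {Ω : Type} {mΩ : MeasurableSpace Ω} {P : Measure Ω}
  {F : Filtration ℝ mΩ} {B Y : ℝ → Ω → Fin d → ℝ} {L : ℝ → Ω → Fin d → Fin d → ℝ}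
  {Z : ℝ → Ω → Fin d → Fin d → Fin d → ℝ} {A : ℝ → Set Ω} {N K ρ σ : ℝ}

theorem localSize_succ_le (h : LocalizedSolution P F B Y L Z A N K ρ σ) (n k : ℕ) :
    localSize P Y A n (k + 1) ≤ localSize P Y A n k + localIncr P Y A n k := by
  set s := dyadic n k with hs
  set t := dyadic n (k + 1) with ht
  have hTS : A t ⊆ A s := h.antitone_A (dyadic_mono n (Nat.le_succ k))
  have hsplit : (A t).indicator (Y t) = (A t).indicator (Y s) + (A t).indicator (Y t - Y s) := by
    rw [← Set.indicator_add', add_sub_cancel]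
  unfold localSize localIncr
  rw [← ht, ← hs, hsplit]
  refine (eLpNorm_add_le ((h.measurable_Y s).indicator (h.measurableSet t)).aestronglyMeasurable
    (((h.measurable_Y t).sub (h.measurable_Y s)).indicator
      (h.measurableSet t)).aestronglyMeasurable one_le_two).trans (add_le_add (eLpNorm_mono
        fun ω => ?_) le_rfl)
  by_cases hω : ω ∈ A t
  · rw [Set.indicator_of_mem hω, Set.indicator_of_mem (hTS hω)]
  · rw [Set.indicator_of_notMem hω, norm_zero]; positivity

/-- Chaining along binary expansions inside a dyadic block. -/
theorem localSize_le_of_localIncr_le (h : LocalizedSolution P F B Y L Z A N K ρ σ)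
    (hρ1 : ρ < 1) {M i : ℕ} {G : ℝ} (hG : 0 ≤ G) (h0 : localSize P Y A M i = 0)
    (hD : ∀ q, ∀ l < 2 ^ q,
      localIncr P Y A (M + q) (i * 2 ^ q + l) ≤ ENNReal.ofReal (G * ρ ^ (M + q)))
    {q l : ℕ} (hl : l ≤ 2 ^ q) :
    localSize P Y A (M + q) (i * 2 ^ q + l) ≤ ENNReal.ofReal (G * (1 / (1 - ρ))) := by
  have hρ := h.ρ_pos
  have key : ∀ q, ∀ l ≤ 2 ^ q, localSize P Y A (M + q) (i * 2 ^ q + l) ≤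
      ENNReal.ofReal (∑ r ∈ Finset.range (q + 1), G * ρ ^ (M + r)) := by
    intro q
    induction q with
    | zero =>
      intro l hl
      have h01 : l = 0 ∨ l = 1 := by simp at hl; omega
      rcases h01 with rfl | rfl
      · simp [h0]
      · have := h.localSize_succ_le M i
        rw [h0, zero_add] at this
        simpa using this.trans (by simpa using hD 0 0 (by simp))
    | succ q ih =>
      intro l hl
      rw [Finset.sum_range_succ, ENNReal.ofReal_add (by positivity) (by positivity)]
      have hcoarse : ∀ l', localSize P Y A (M + (q + 1)) (i * 2 ^ (q + 1) + 2 * l') =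
          localSize P Y A (M + q) (i * 2 ^ q + l') := fun l' => by
        rw [← localSize_add_mul_pow P Y A (M + q) _ 1, add_assoc M q 1]
        congr 1
        ring
      have hpow : 2 ^ (q + 1) = 2 * 2 ^ q := by ring
      rcases Nat.even_or_odd' l with ⟨l', rfl | rfl⟩
      · rw [hcoarse]
        exact (ih l' (by omega)).trans le_self_add
      · refine (h.localSize_succ_le _ _).trans (add_le_add ?_ (hD (q + 1) (2 * l') (by omega)))
        exact (hcoarse l').trans_le (ih l' (by omega))
  refine (key q l hl).trans (ENNReal.ofReal_le_ofReal ?_)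
  rw [← Finset.mul_sum]
  gcongr
  refine le_trans (Finset.sum_le_sum fun r _ => ?_) (sum_range_pow_le hρ.le hρ1 (q + 1))
  exact pow_le_pow_of_le_one hρ.le hρ1.le (Nat.le_add_left _ _)

/-- On a sufficiently short dyadic block, a localized solution which vanishes at the left endpoint
vanishes throughout. -/
theorem localSize_eq_zero_of_block [IsProbabilityMeasure P]
    (h : LocalizedSolution P F B Y L Z A N K ρ σ)
    (hστ : σ ≤ √(1 / 2)) (hρ1 : ρ < 1) (hρσ : 2 * (ρ * σ) < 1) {M i : ℕ} (hi : i < 2 ^ M)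
    (hM : ∀ n ≥ M, (d * N * (1 / (1 - ρ)) + d * N * (1 / (1 - 2 * (ρ * σ))) +
      d ^ 3 * K * (1 / (1 - ρ))) * √(1 / 2) ^ n ≤ ρ ^ n / 2)
    (h0 : localSize P Y A M i = 0) {q l : ℕ} (hl : l ≤ 2 ^ q) :
    localSize P Y A (M + q) (i * 2 ^ q + l) = 0 := by
  have hN := h.N_nonneg
  have hρ := h.ρ_pos
  have hc : 0 ≤ 1 / (1 - ρ) := by
    have : 0 < 1 - ρ := by linarith
    positivity
  have hD : ∀ r q : ℕ, ∀ l < 2 ^ q, localIncr P Y A (M + q) (i * 2 ^ q + l) ≤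
      ENNReal.ofReal (N * (1 / 2) ^ r * ρ ^ (M + q)) := by
    intro r
    induction r with
    | zero =>
      intro q l hl
      have hpos : 0 ≤ N * ρ ^ (M + q) := by positivity
      refine (eLpNorm_le_of_ae_bound (C := N * ρ ^ (M + q)) (ae_of_all _ fun ω => ?_)).trans
        (by simp)
      by_cases hω : ω ∈ A (dyadic (M + q) (i * 2 ^ q + l + 1))
      · rw [Set.indicator_of_mem hω]
        exact h.norm_Y_sub_le _ _ (subinterval_lt hi hl) ω hω
      · rwa [Set.indicator_of_notMem hω, norm_zero]
    | succ r ih =>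
      intro q l hl
      have hG : 0 ≤ N * (1 / 2 : ℝ) ^ r := by positivity
      have hidx : ∀ p l', (i * 2 ^ q + l) * 2 ^ p + l' = i * 2 ^ (q + p) + (l * 2 ^ p + l') :=
        fun p l' => by ring
      refine (h.localIncr_le (subinterval_lt hi hl) hG (mul_nonneg hG hc) hστ hρ1 hρσ
        (fun p l' hl' => ?_) (fun p l' hl' => ?_)).trans (ENNReal.ofReal_le_ofReal ?_)
      · rw [hidx, add_assoc]
        exact ih (q + p) _ (subinterval_lt hl hl')
      · rw [hidx, add_assoc]
        exact h.localSize_le_of_localIncr_le hρ1 hG h0 ih (subinterval_lt hl hl').le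
      · calc _ = N * (1 / 2 : ℝ) ^ r * ((d * N * (1 / (1 - ρ)) + d * N * (1 / (1 - 2 * (ρ * σ))) +
              d ^ 3 * K * (1 / (1 - ρ))) * √(1 / 2) ^ (M + q)) := by ring
          _ ≤ N * (1 / 2 : ℝ) ^ r * (ρ ^ (M + q) / 2) :=
            mul_le_mul_of_nonneg_left (hM _ (Nat.le_add_right _ _)) hG
          _ = _ := by ring
  have hlim : Tendsto (fun r : ℕ => ENNReal.ofReal (N * (1 / 2) ^ r * (1 / (1 - ρ)))) atTop
      (nhds 0) := by
    have : Tendsto (fun r : ℕ => N * (1 / 2 : ℝ) ^ r * (1 / (1 - ρ))) atTop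
        (nhds (N * 0 * (1 / (1 - ρ)))) :=
      ((_root_.tendsto_pow_atTop_nhds_zero_of_lt_one (by norm_num) (by norm_num)).const_mul N).mul_const _
    simpa using ENNReal.tendsto_ofReal this
  exact le_antisymm (ge_of_tendsto' hlim fun r => h.localSize_le_of_localIncr_le hρ1
    (by positivity) h0 (hD r) hl) zero_le

theorem localSize_eq_zero [IsProbabilityMeasure P]
    (h : LocalizedSolution P F B Y L Z A N K ρ σ)
    (hστ : σ ≤ √(1 / 2)) (hτρ : √(1 / 2) < ρ) (hρ1 : ρ < 1) (hρσ : 2 * (ρ * σ) < 1)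
    {n k : ℕ} (hk : k ≤ 2 ^ n) : localSize P Y A n k = 0 := by
  have hρ := h.ρ_pos
  obtain ⟨M, hM⟩ : ∃ M : ℕ, ∀ n ≥ M, (d * N * (1 / (1 - ρ)) + d * N * (1 / (1 - 2 * (ρ * σ))) +
      d ^ 3 * K * (1 / (1 - ρ))) * √(1 / 2) ^ n ≤ ρ ^ n / 2 := by
    have hlim := (_root_.tendsto_pow_atTop_nhds_zero_of_lt_one (r := √(1 / 2) / ρ) (by positivity)
      ((div_lt_one hρ).2 hτρ)).const_mul (d * N * (1 / (1 - ρ)) +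
        d * N * (1 / (1 - 2 * (ρ * σ))) + d ^ 3 * K * (1 / (1 - ρ)))
    rw [mul_zero] at hlim
    obtain ⟨M, hM⟩ := eventually_atTop.1 (hlim.eventually_le_const (u := 1 / 2) (by norm_num))
    refine ⟨M, fun n hn => ?_⟩
    have := hM n hn
    rw [div_pow, ← mul_div_assoc, div_le_iff₀ (by positivity)] at this
    linarith
  have hgrid : ∀ i ≤ 2 ^ M, localSize P Y A M i = 0 := by
    intro i
    induction i with
    | zero =>
      intro _
      have : Y 0 = 0 := funext h.initial
      simp [localSize, dyadic_zero_right, this]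
    | succ i ih =>
      intro hi
      have := h.localSize_eq_zero_of_block hστ hρ1 hρσ (Nat.lt_of_succ_le hi) hM
        (ih (Nat.le_of_succ_le hi)) (q := 0) (l := 1) (by simp)
      simpa using this
  rcases hk.eq_or_lt with rfl | hlt
  · rw [← localSize_add_mul_pow P Y A n _ M, add_comm, mul_comm, localSize_add_mul_pow]
    exact hgrid _ le_rfl
  · have hi : k * 2 ^ M / 2 ^ n < 2 ^ M :=
      Nat.div_lt_of_lt_mul (Nat.mul_lt_mul_of_pos_right hlt (by positivity))
    rw [← localSize_add_mul_pow P Y A n k M, add_comm, ← Nat.div_add_mod' (k * 2 ^ M) (2 ^ n)]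
    exact h.localSize_eq_zero_of_block hστ hρ1 hρσ hi hM (hgrid _ hi.le)
      (Nat.mod_lt _ (by positivity)).le

theorem ae_eq_zero [IsProbabilityMeasure P]
    (h : LocalizedSolution P F B Y L Z A N K ρ σ)
    (hστ : σ ≤ √(1 / 2)) (hτρ : √(1 / 2) < ρ) (hρ1 : ρ < 1) (hρσ : 2 * (ρ * σ) < 1) :
    ∀ᵐ ω ∂P, ∀ n k, k ≤ 2 ^ n → ω ∈ A (dyadic n k) → Y (dyadic n k) ω = 0 := by
  simp only [ae_all_iff]
  intro n k hk
  have h0 := h.localSize_eq_zero hστ hτρ hρ1 hρσ hk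
  rw [localSize, eLpNorm_eq_zero_iff ((h.measurable_Y _).indicator
    (h.measurableSet _)).aestronglyMeasurable two_ne_zero] at h0
  filter_upwards [h0] with ω hω hωA
  simpa [hωA] using hω

end LocalizedSolution

theorem measurableSet_norm_sub_le {Ω E : Type*} {m : MeasurableSpace Ω} [NormedAddCommGroup E]
    [MeasurableSpace E] [BorelSpace E] [SecondCountableTopology E] {f g : Ω → E}
    (hf : Measurable f) (hg : Measurable g) (c : ℝ) : MeasurableSet {ω | ‖f ω - g ω‖ ≤ c} :=
  measurableSet_le (hf.sub hg).norm measurable_const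

/-- The event that `X` has `γ`-Hölder constant at most `N` along the rationals of `[0, t]`. -/
def holderEvent {Ω E : Type*} [NormedAddCommGroup E] (X : ℝ → Ω → E) (N γ t : ℝ) : Set Ω :=
  {ω | ∀ u v : ℚ, 0 ≤ u → u ≤ v → (v : ℝ) ≤ t → ‖X v ω - X u ω‖ ≤ N * ((v : ℝ) - u) ^ γ}

section HolderEvent

variable {Ω E : Type*} [NormedAddCommGroup E] {X : ℝ → Ω → E} {N γ : ℝ}

theorem antitone_holderEvent : Antitone (holderEvent X N γ) :=
  fun _ _ hst _ hω u v hu huv hv => hω u v hu huv (hv.trans hst)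

theorem measurableSet_holderEvent [MeasurableSpace E] [BorelSpace E] [SecondCountableTopology E]
    {mΩ : MeasurableSpace Ω} {F : Filtration ℝ mΩ} (hX : ∀ t, Measurable[F t] (X t)) (t : ℝ) :
    MeasurableSet[F t] (holderEvent X N γ t) := by
  simp only [holderEvent, Set.ofPred_forall]
  refine MeasurableSet.iInter fun u => MeasurableSet.iInter fun v => MeasurableSet.iInter fun _ =>
    MeasurableSet.iInter fun huv => MeasurableSet.iInter fun hv => ?_
  have huv' : (u : ℝ) ≤ v := by exact_mod_cast huv
  have h1 : Measurable[F t] (X v) := (hX v).mono (F.mono hv) le_rfl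
  have h2 : Measurable[F t] (X u) := (hX u).mono (F.mono (huv'.trans hv)) le_rfl
  exact measurableSet_norm_sub_le h1 h2 _

theorem norm_sub_le_of_mem_holderEvent {n k l : ℕ} (hkl : k ≤ l) {ω : Ω}
    (hω : ω ∈ holderEvent X N γ (dyadic n l)) :
    ‖X (dyadic n l) ω - X (dyadic n k) ω‖ ≤ N * (dyadic n l - dyadic n k) ^ γ := by
  have hcast : ∀ j : ℕ, dyadic n j = ((j / 2 ^ n : ℚ) : ℝ) := fun j => by simp [dyadic]
  have := hω (k / 2 ^ n) (l / 2 ^ n) (by positivity) (by gcongr) (hcast l).ge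
  rwa [← hcast, ← hcast] at this

theorem mem_holderEvent {C t : ℝ} {ω : Ω} (ht : t ≤ 1) (hCN : C ≤ N)
    (hX : ∀ s ∈ Set.Icc (0 : ℝ) 1, ∀ t ∈ Set.Icc (0 : ℝ) 1,
      ‖X t ω - X s ω‖ ≤ C * |t - s| ^ γ) : ω ∈ holderEvent X N γ t := by
  intro u v hu huv hv
  have hu' : (0 : ℝ) ≤ u := by exact_mod_cast hu
  have huv' : (u : ℝ) ≤ v := by exact_mod_cast huv
  have h := hX u ⟨hu', by linarith⟩ v ⟨by linarith, by linarith⟩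
  rw [abs_of_nonneg (sub_nonneg.2 huv')] at h
  exact h.trans (mul_le_mul_of_nonneg_right hCN (Real.rpow_nonneg (sub_nonneg.2 huv') _))

end HolderEvent

theorem dyadic_mul_div (n b p : ℕ) (hb : b ≠ 0) (x : ℝ) :
    dyadic n b * x / ((b * 2 ^ p : ℕ) : ℝ) = x / 2 ^ (n + p) := by
  unfold dyadic
  have : (b : ℝ) ≠ 0 := by exact_mod_cast hb
  push_cast
  rw [pow_add]
  field_simp

theorem sum_range_succ_mul_sub {E : Type*} [AddCommGroup E] (f : ℕ → E) (k m : ℕ) :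
    ∑ l ∈ Finset.range ((k + 1) * m), f l - ∑ l ∈ Finset.range (k * m), f l =
      ∑ l ∈ Finset.range m, f (k * m + l) := by
  rw [add_mul, one_mul, Finset.sum_range_add, add_sub_cancel_left]

/-- Dyadic increments of a solution are almost sure limits of Riemann sums with common mesh. -/
theorem exists_seq_tendsto_increment {d : ℕ} {Ω : Type} {mΩ : MeasurableSpace Ω} {P : Measure Ω}
    {B Y YI MI : ℝ → Ω → Fin d → ℝ} {L : ℝ → Ω → Fin d → Fin d → ℝ}
    {Z : ℝ → Ω → Fin d → Fin d → Fin d → ℝ} (hY0 : ∀ ω, Y 0 ω = 0)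
    (hYI : ∀ᵐ ω ∂P, ∀ t ∈ Set.Icc (0:ℝ) 1,
      Tendsto (fun m : ℕ => fun ℓ : Fin d => ∑ k ∈ Finset.range m, ∑ j : Fin d,
          Y (t * k / m) ω j * (L (t * (k+1) / m) ω ℓ j - L (t * k / m) ω ℓ j))
        atTop (nhds (YI t ω)))
    (hMI : ∀ t ∈ Set.Icc (0:ℝ) 1,
      MeasureTheory.TendstoInMeasure P
        (fun m : ℕ => fun ω => fun ℓ : Fin d =>
          ∑ k ∈ Finset.range m, ∑ j : Fin d, ∑ i : Fin d,
            Z (t * k / m) ω ℓ j i * Y (t * k / m) ω j *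
              (B (t * (k+1) / m) ω i - B (t * k / m) ω i))
        atTop (MI t))
    (heq : ∀ t ∈ Set.Icc (0:ℝ) 1, ∀ᵐ ω ∂P, Y t ω = YI t ω + MI t ω)
    {n k : ℕ} (hk : k < 2 ^ n) :
    ∃ ns : ℕ → ℕ, ∀ᵐ ω ∂P,
      Tendsto (fun q => youngSum Y L n k (ns q) ω + itoSum Z Y B n k (ns q) ω) atTop
        (nhds (Y (dyadic n (k + 1)) ω - Y (dyadic n k) ω)) := by
  let YP : ℕ → ℕ → Ω → Fin d → ℝ := fun b p ω => ∑ l ∈ Finset.range (b * 2 ^ p),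
    youngTerm (Y (dyadic (n + p) l) ω) (L (dyadic (n + p) (l + 1)) ω - L (dyadic (n + p) l) ω)
  let IP : ℕ → ℕ → Ω → Fin d → ℝ := fun b p ω => ∑ l ∈ Finset.range (b * 2 ^ p),
    itoTerm (Z (dyadic (n + p) l) ω) (Y (dyadic (n + p) l) ω)
      (B (dyadic (n + p) (l + 1)) ω - B (dyadic (n + p) l) ω)
  have hmul : ∀ b ≠ 0, Tendsto (fun p : ℕ => b * 2 ^ p) atTop atTop := fun b hb =>
    (_root_.tendsto_pow_atTop_atTop_of_one_lt (r := (2 : ℕ)) one_lt_two).const_mul_atTop' (Nat.pos_of_ne_zero hb)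
  have hYI0 : ∀ᵐ ω ∂P, YI 0 ω = 0 := by
    filter_upwards [hYI] with ω hω
    have h := hω 0 (by simp)
    simp only [zero_mul, zero_div, sub_self, mul_zero, Finset.sum_const_zero] at h
    exact tendsto_nhds_unique h tendsto_const_nhds
  have hYP : ∀ b ≤ 2 ^ n, ∀ᵐ ω ∂P,
      Tendsto (fun p => YP b p ω) atTop (nhds (YI (dyadic n b) ω)) := by
    intro b hb
    rcases eq_or_ne b 0 with rfl | hb0
    · filter_upwards [hYI0] with ω hω
      simp [YP, dyadic_zero_right, hω]
    · filter_upwards [hYI] with ω hω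
      refine ((hω _ (dyadic_mem_Icc hb)).comp (hmul b hb0)).congr fun p => ?_
      funext a
      simp only [Function.comp, YP, Finset.sum_apply, youngTerm, Pi.sub_apply,
        dyadic_mul_div n b p hb0]
      simp [dyadic]
  have hIP : ∀ b ≤ 2 ^ n,
      TendstoInMeasure P (IP b) atTop (fun ω => Y (dyadic n b) ω - YI (dyadic n b) ω) := by
    intro b hb
    rcases eq_or_ne b 0 with rfl | hb0
    · have h0 : IP 0 = fun _ _ => 0 := by funext p ω; simp [IP]
      rw [h0]
      refine TendstoInMeasure.congr_right (f := fun _ _ => (0 : Fin d → ℝ)) (g := fun _ => 0) ?_ ?_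
      · filter_upwards [hYI0] with ω hω
        simp [dyadic_zero_right, hY0, hω]
      · intro ε hε
        simp [hε.not_ge]
    · refine TendstoInMeasure.congr_right (g := MI (dyadic n b)) ?_ ?_
      · filter_upwards [heq _ (dyadic_mem_Icc hb)] with ω hω
        rw [hω, add_sub_cancel_left]
      · refine ((hMI _ (dyadic_mem_Icc hb)).comp (hmul b hb0)).congr_left fun p =>
          ae_of_all _ fun ω => ?_
        funext a
        simp only [Function.comp, IP, Finset.sum_apply, itoTerm, Pi.sub_apply,
          dyadic_mul_div n b p hb0]
        simp [dyadic]
  obtain ⟨ns₁, hns₁, hlim₁⟩ := (hIP (k + 1) hk).exists_seq_tendsto_ae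
  obtain ⟨ns₂, hns₂, hlim₂⟩ := ((hIP k hk.le).comp hns₁.tendsto_atTop).exists_seq_tendsto_ae
  refine ⟨ns₁ ∘ ns₂, ?_⟩
  filter_upwards [hlim₁, hlim₂, hYP (k + 1) hk, hYP k hk.le] with ω h1 h2 h3 h4
  have hns := hns₁.tendsto_atTop.comp hns₂.tendsto_atTop
  have hall := ((h3.comp hns).sub (h4.comp hns)).add ((h1.comp hns₂.tendsto_atTop).sub h2)
  convert! hall using 2
  · simp only [Function.comp, YP, IP, youngSum, itoSum]
    rw [sum_range_succ_mul_sub, sum_range_succ_mul_sub]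
  · abel

/-- uniqueness (i.e. triviality of the solution started from `0`) for the
linear hybrid Young–Itô equation
`Y^ℓ_t = ∫₀^t Y^j dL^{ℓ,j} + ∫₀^t Z^{ℓ,j,i} Y^j dB^i`. -/
theorem stmt_4 (d : ℕ) (α ε θ β K : ℝ)
    (hα : α ∈ Set.Ioo (0:ℝ) 1) (hε : 0 < ε)
    (hθ : θ ∈ Set.Ioc ((1 - α)/2 + ε) 1)
    (hβ1 : 1 - θ < β) (hβ2 : β < 1/2)
    (Ω : Type) (mΩ : MeasurableSpace Ω) (P : Measure Ω) (_ : IsProbabilityMeasure P)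
    (F : MeasureTheory.Filtration ℝ mΩ) (B : ℝ → Ω → (Fin d → ℝ))
    (hB : IsBrownianMotion P F (Fin d) B)
    (L : ℝ → Ω → (Fin d → Fin d → ℝ)) (KL : Ω → ℝ)
    (hLadapted : ∀ t : ℝ, Measurable[F t] (L t))
    -- `L` is pathwise `θ`-Hölder on `[0,1]`:
    (hLhol : ∀ᵐ ω ∂P, ∀ s ∈ Set.Icc (0:ℝ) 1, ∀ t ∈ Set.Icc (0:ℝ) 1,
      ‖L t ω - L s ω‖ ≤ KL ω * |t - s| ^ θ)
    (Z : ℝ → Ω → (Fin d → Fin d → Fin d → ℝ))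
    (hZadapted : ∀ t : ℝ, Measurable[F t] (Z t))
    (hZbd : ∀ t ∈ Set.Icc (0:ℝ) 1, ∀ ω, ‖Z t ω‖ ≤ K)
    (Y : ℝ → Ω → (Fin d → ℝ)) (KY : Ω → ℝ)
    (hYadapted : ∀ t : ℝ, Measurable[F t] (Y t))
    -- `Y` is a.s. `β`-Hölder on `[0,1]`:
    (hYhol : ∀ᵐ ω ∂P, ∀ s ∈ Set.Icc (0:ℝ) 1, ∀ t ∈ Set.Icc (0:ℝ) 1,
      ‖Y t ω - Y s ω‖ ≤ KY ω * |t - s| ^ β)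
    (hY0 : ∀ ω, Y 0 ω = 0)
    -- the Young integral part `YI`:
    (YI : ℝ → Ω → (Fin d → ℝ))
    (hYI : ∀ᵐ ω ∂P, ∀ t ∈ Set.Icc (0:ℝ) 1,
      Tendsto (fun m : ℕ => fun ℓ : Fin d => ∑ k ∈ Finset.range m, ∑ j : Fin d,
          Y (t * k / m) ω j * (L (t * (k+1) / m) ω ℓ j - L (t * k / m) ω ℓ j))
        atTop (nhds (YI t ω)))
    -- the Itô integral part `MI` (limit in probability of left Riemann sums):
    (MI : ℝ → Ω → (Fin d → ℝ))
    (hMI : ∀ t ∈ Set.Icc (0:ℝ) 1,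
      MeasureTheory.TendstoInMeasure P
        (fun m : ℕ => fun ω => fun ℓ : Fin d =>
          ∑ k ∈ Finset.range m, ∑ j : Fin d, ∑ i : Fin d,
            Z (t * k / m) ω ℓ j i * Y (t * k / m) ω j *
              (B (t * (k+1) / m) ω i - B (t * k / m) ω i))
        atTop (MI t))
    -- the equation `Y = ∫ Y dL + ∫ Z Y dB`:
    (heq : ∀ t ∈ Set.Icc (0:ℝ) 1, ∀ᵐ ω ∂P, Y t ω = YI t ω + MI t ω) :
    ∀ᵐ ω ∂P, ∀ t ∈ Set.Icc (0:ℝ) 1, Y t ω = 0 := by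
  have hβ0 : 0 < β := by linarith [hθ.2]
  have hθ0 : 1 / 2 < θ := by linarith
  have hK : 0 ≤ K := by
    obtain ⟨ω⟩ := P.nonempty_of_neZero
    exact (norm_nonneg _).trans (hZbd 0 (by simp) ω)
  have hsqrt : √(1 / 2 : ℝ) = (1 / 2) ^ (1 / 2 : ℝ) := Real.sqrt_eq_rpow _
  have hστ : (1 / 2 : ℝ) ^ θ ≤ √(1 / 2) := by
    rw [hsqrt]
    exact Real.rpow_le_rpow_of_exponent_ge (by norm_num) (by norm_num) hθ0.le
  have hτρ : √(1 / 2) < (1 / 2 : ℝ) ^ β := by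
    rw [hsqrt]
    exact Real.rpow_lt_rpow_of_exponent_gt (by norm_num) (by norm_num) hβ2
  have hρ1 : (1 / 2 : ℝ) ^ β < 1 := Real.rpow_lt_one (by norm_num) (by norm_num) hβ0
  have hρσ : 2 * ((1 / 2 : ℝ) ^ β * (1 / 2) ^ θ) < 1 := by
    rw [← Real.rpow_add (by norm_num)]
    have := Real.rpow_lt_rpow_of_exponent_gt (x := 1 / 2) (by norm_num) (by norm_num)
      (show 1 < β + θ by linarith)
    rw [Real.rpow_one] at this
    linarith
  have hloc : ∀ N : ℕ, LocalizedSolution P F B Y L Z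
      (fun t => holderEvent Y N β t ∩ holderEvent L N θ t) N K ((1 / 2) ^ β) ((1 / 2) ^ θ) :=
    fun N =>
    { brownian := hB
      adapted_Y := hYadapted
      adapted_L := hLadapted
      adapted_Z := hZadapted
      measurableSet_A := fun t => (measurableSet_holderEvent hYadapted t).inter
        (measurableSet_holderEvent hLadapted t)
      antitone_A := fun _ _ hst =>
        Set.inter_subset_inter (antitone_holderEvent hst) (antitone_holderEvent hst)
      N_nonneg := N.cast_nonneg
      K_nonneg := hK
      ρ_pos := by positivity
      σ_pos := by positivity
      norm_Z_le := hZbd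
      initial := hY0
      norm_Y_le := fun n k hk ω hω => by
        have h := norm_sub_le_of_mem_holderEvent (Nat.zero_le k) hω.1
        rw [dyadic_zero_right, hY0, sub_zero, sub_zero] at h
        exact h.trans (mul_le_of_le_one_right N.cast_nonneg
          (Real.rpow_le_one (dyadic_nonneg n k) (dyadic_le_one hk) hβ0.le))
      norm_Y_sub_le := fun n k _ ω hω => by
        rw [← dyadic_succ_sub_rpow n k]
        exact norm_sub_le_of_mem_holderEvent (Nat.le_succ k) hω.1
      norm_L_sub_le := fun n k _ ω hω => by
        rw [← dyadic_succ_sub_rpow n k]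
        exact norm_sub_le_of_mem_holderEvent (Nat.le_succ k) hω.2
      tendsto_increment := fun n k hk => exists_seq_tendsto_increment hY0 hYI hMI heq hk }
  have hzero := ae_all_iff.2 fun N => (hloc N).ae_eq_zero hστ hτρ hρ1 hρσ
  filter_upwards [hzero, hYhol, hLhol] with ω hω hYω hLω t ht
  obtain ⟨N, hN⟩ := exists_nat_ge (max (KY ω) (KL ω))
  have hdyadic : ∀ n k, k ≤ 2 ^ n → Y (dyadic n k) ω = 0 := fun n k hk =>
    hω N n k hk ⟨mem_holderEvent (dyadic_le_one hk) ((le_max_left _ _).trans hN) hYω,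
      mem_holderEvent (dyadic_le_one hk) ((le_max_right _ _).trans hN) hLω⟩
  have hbound : ∀ n : ℕ, ‖Y t ω‖ ≤ N * ((1 / 2 : ℝ) ^ β) ^ n := by
    intro n
    set k := ⌊t * 2 ^ n⌋₊ with hk
    have hpow : (0 : ℝ) < 2 ^ n := by positivity
    have hle : (k : ℝ) ≤ t * 2 ^ n := Nat.floor_le (mul_nonneg ht.1 hpow.le)
    have hlt : t * 2 ^ n < k + 1 := Nat.lt_floor_add_one _
    have hk2 : k ≤ 2 ^ n := by
      have : (k : ℝ) ≤ 2 ^ n := hle.trans (mul_le_of_le_one_left hpow.le ht.2)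
      exact_mod_cast this
    have h1 : dyadic n k ≤ t := (div_le_iff₀ hpow).2 hle
    have h2 : t ≤ dyadic n (k + 1) := by
      refine (le_div_iff₀ hpow).2 ?_
      push_cast
      exact hlt.le
    have h := hYω _ (dyadic_mem_Icc hk2) t ht
    rw [hdyadic n k hk2, sub_zero, abs_of_nonneg (sub_nonneg.2 h1)] at h
    rw [← dyadic_succ_sub_rpow n k]
    refine h.trans (mul_le_mul ((le_max_left _ _).trans hN) ?_
      (Real.rpow_nonneg (sub_nonneg.2 h1) _) N.cast_nonneg)
    exact Real.rpow_le_rpow (sub_nonneg.2 h1) (by linarith) hβ0.le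
  have hlim := (_root_.tendsto_pow_atTop_nhds_zero_of_lt_one (r := (1 / 2 : ℝ) ^ β) (by positivity)
    hρ1).const_mul (N : ℝ)
  rw [mul_zero] at hlim
  exact norm_le_zero_iff.1 (ge_of_tendsto' hlim hbound)
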